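/- Time derivative of the potential energy along the flow: Let d ≥ 1, let V : ℝ^d → ℝ be C¹ with V and ∇V of at most polynomial growth, let h : [0,∞) → ℝ be continuous, and let ψ be a classical Schwartz-class solution of i∂_tψ = (−Δ + V)ψ − h(|ψ|²)ψ on ℝ × ℝ^d. Then t ↦ (1/2)∫_{ℝ^d} V(x)|ψ(t,x)|² dx is differentiable, and its derivative equals ∫_{ℝ^d} ∇V(x) · Im( conj(ψ(t,x)) ∇ψ(t,x) ) dx, where ∇ψ is the spatial gradient. -/

import Mathlib

open MeasureTheory

noncomputable section

/-- Spatial partial derivative in the `j`-th coordinate direction. -/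
def pdC (d : ℕ) (j : Fin d) (f : EuclideanSpace ℝ (Fin d) → ℂ)
    (x : EuclideanSpace ℝ (Fin d)) : ℂ :=
  fderiv ℝ f x (EuclideanSpace.single j (1 : ℝ))

/-- Spatial Laplacian of a complex-valued function on `ℝ^d`. -/
def lapC (d : ℕ) (f : EuclideanSpace ℝ (Fin d) → ℂ) (x : EuclideanSpace ℝ (Fin d)) : ℂ :=
  ∑ j, pdC d j (fun y => pdC d j f y) x

section Decay

variable {E F : Type*} [NormedAddCommGroup E] [NormedAddCommGroup F]

/-- `f` decays faster than every inverse power of `1 + ‖x‖`. -/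
def RapidDecay (f : E → F) : Prop :=
  ∀ k : ℕ, ∃ C : ℝ, ∀ x, (1 + ‖x‖) ^ k * ‖f x‖ ≤ C

theorem RapidDecay.mono {F' : Type*} [NormedAddCommGroup F'] {f : E → F} {g : E → F'}
    (hf : RapidDecay f) (hgf : ∀ x, ‖g x‖ ≤ ‖f x‖) : RapidDecay g := fun k =>
  (hf k).imp fun _ hC x =>
    (mul_le_mul_of_nonneg_left (hgf x) (by positivity)).trans (hC x)

theorem RapidDecay.im_conj_mul {f g : E → ℂ} (hf : RapidDecay f) (hg : RapidDecay g) :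
    RapidDecay fun x => ((starRingEnd ℂ) (f x) * g x).im := by
  intro k
  obtain ⟨C, hC⟩ := hf 0
  obtain ⟨D, hD⟩ := hg k
  refine ⟨C * D, fun x => ?_⟩
  have hf' : ‖f x‖ ≤ C := by simpa using hC x
  calc (1 + ‖x‖) ^ k * ‖((starRingEnd ℂ) (f x) * g x).im‖
      ≤ (1 + ‖x‖) ^ k * ‖(starRingEnd ℂ) (f x) * g x‖ :=
        mul_le_mul_of_nonneg_left (Complex.abs_im_le_norm _) (by positivity)
    _ = ‖f x‖ * ((1 + ‖x‖) ^ k * ‖g x‖) := by rw [norm_mul, RCLike.norm_conj]; ring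
    _ ≤ C * D := mul_le_mul hf' (hD x) (by positivity) ((norm_nonneg _).trans hf')

theorem growth_mul_decay_le {a b r C D : ℝ} {n m : ℕ} (hr : 0 ≤ r) (hC : 0 ≤ C) (hb : 0 ≤ b)
    (ha : a ≤ C * (1 + r) ^ n) (hD : (1 + r) ^ (n + m) * b ≤ D) :
    a * b ≤ C * D * (1 + r) ^ (-(m : ℝ)) := by
  have hpos : 0 < (1 + r) ^ m := by positivity
  rw [Real.rpow_neg (by positivity), Real.rpow_natCast, ← div_eq_mul_inv, le_div_iff₀ hpos]
  calc a * b * (1 + r) ^ m ≤ C * (1 + r) ^ n * b * (1 + r) ^ m := by gcongr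
    _ = C * ((1 + r) ^ (n + m) * b) := by rw [pow_add]; ring
    _ ≤ C * D := mul_le_mul_of_nonneg_left hD hC

theorem RapidDecay.integrable_mul [NormedSpace ℝ E] [FiniteDimensional ℝ E] [MeasurableSpace E]
    [BorelSpace E] {μ : Measure E} [μ.IsAddHaarMeasure] {g u : E → ℝ}
    (hu : RapidDecay u) (hgc : Continuous g) (huc : Continuous u)
    (hg : ∃ C : ℝ, ∃ n : ℕ, ∀ x, |g x| ≤ C * (1 + ‖x‖) ^ n) :
    Integrable (fun x => g x * u x) μ := by
  obtain ⟨C, n, hC⟩ := hg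
  obtain ⟨D, hD⟩ := hu (n + (Module.finrank ℝ E + 1))
  have hC0 : 0 ≤ C := (abs_nonneg _).trans (by simpa using hC 0)
  refine ((integrable_one_add_norm (μ := μ)
    (r := ((Module.finrank ℝ E + 1 : ℕ) : ℝ)) (by push_cast; linarith)).const_mul (C * D)).mono'
    (hgc.mul huc).aestronglyMeasurable (.of_forall fun x => ?_)
  rw [norm_mul]
  exact growth_mul_decay_le (norm_nonneg x) hC0 (norm_nonneg _) (hC x) (hD x)

end Decay

section PartialDerivatives

variable {d : ℕ} {f : EuclideanSpace ℝ (Fin d) → ℂ}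

theorem contDiff_pdC (hf : ContDiff ℝ (⊤ : ℕ∞) f) (j : Fin d) :
    ContDiff ℝ (⊤ : ℕ∞) (pdC d j f) :=
  (hf.fderiv_right (m := (⊤ : ℕ∞)) (by simp)).clm_apply contDiff_const

theorem norm_pdC_le (j : Fin d) (x : EuclideanSpace ℝ (Fin d)) :
    ‖pdC d j f x‖ ≤ ‖iteratedFDeriv ℝ 1 f x‖ := by
  rw [norm_iteratedFDeriv_one]
  simpa [pdC] using (fderiv ℝ f x).le_opNorm (EuclideanSpace.single j (1 : ℝ))

theorem norm_pdC_pdC_le (hf : ContDiff ℝ (⊤ : ℕ∞) f) (j : Fin d)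
    (x : EuclideanSpace ℝ (Fin d)) :
    ‖pdC d j (pdC d j f) x‖ ≤ ‖iteratedFDeriv ℝ 2 f x‖ := by
  have hdiff : DifferentiableAt ℝ (fderiv ℝ f) x :=
    (hf.fderiv_right (m := (⊤ : ℕ∞)) (by simp)).differentiable (by simp) x
  have heq : pdC d j (pdC d j f) x =
      iteratedFDeriv ℝ 2 f x fun _ => EuclideanSpace.single j (1 : ℝ) := by
    rw [iteratedFDeriv_two_apply]
    change fderiv ℝ (fun y => fderiv ℝ f y (EuclideanSpace.single j (1 : ℝ))) x _ = _
    rw [fderiv_clm_apply hdiff (differentiableAt_const _)]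
    simp
  rw [heq]
  simpa using (iteratedFDeriv ℝ 2 f x).le_opNorm fun _ => EuclideanSpace.single j (1 : ℝ)

theorem differentiableAt_and_fderiv_current (hf : ContDiff ℝ (⊤ : ℕ∞) f) (j : Fin d)
    (x : EuclideanSpace ℝ (Fin d)) :
    DifferentiableAt ℝ (fun y => ((starRingEnd ℂ) (f y) * pdC d j f y).im) x ∧
    fderiv ℝ (fun y => ((starRingEnd ℂ) (f y) * pdC d j f y).im) x
      (EuclideanSpace.single j (1 : ℝ)) =
      ((starRingEnd ℂ) (f x) * pdC d j (pdC d j f) x).im := by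
  have h1 : HasFDerivAt f (fderiv ℝ f x) x :=
    (hf.differentiable (by simp) x).hasFDerivAt
  have h2 : HasFDerivAt (pdC d j f) (fderiv ℝ (pdC d j f) x) x :=
    ((contDiff_pdC hf j).differentiable (by simp) x).hasFDerivAt
  have h3 := Complex.imCLM.hasFDerivAt.comp x
    ((Complex.conjCLE.toContinuousLinearMap.hasFDerivAt.comp x h1).mul h2)
  have h4 : HasFDerivAt (fun y => ((starRingEnd ℂ) (f y) * pdC d j f y).im) _ x := h3
  refine ⟨h4.differentiableAt, ?_⟩
  rw [h4.fderiv]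
  simp [pdC]
  ring

/-- Integration by parts against the current `Im (conj f ∇f)` of a rapidly decaying `f`. -/
theorem integral_mul_im_conj_mul_lapC (hf : ContDiff ℝ (⊤ : ℕ∞) f)
    (hdecay : ∀ n, RapidDecay (iteratedFDeriv ℝ n f))
    {V : EuclideanSpace ℝ (Fin d) → ℝ} (hV : ContDiff ℝ 1 V)
    (hVpoly : ∃ C : ℝ, ∃ n : ℕ, ∀ x, |V x| ≤ C * (1 + ‖x‖) ^ n)
    (hVgradpoly : ∃ C : ℝ, ∃ n : ℕ, ∀ x, ‖fderiv ℝ V x‖ ≤ C * (1 + ‖x‖) ^ n) :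
    ∫ x, V x * ((starRingEnd ℂ) (f x) * lapC d f x).im =
      -∫ x, ∑ j : Fin d, fderiv ℝ V x (EuclideanSpace.single j (1 : ℝ)) *
        ((starRingEnd ℂ) (f x) * pdC d j f x).im := by
  have hf0 : RapidDecay f := (hdecay 0).mono fun x => by simp
  have hf1 (j : Fin d) : RapidDecay (pdC d j f) := (hdecay 1).mono (norm_pdC_le j)
  have hf2 (j : Fin d) : RapidDecay (pdC d j (pdC d j f)) :=
    (hdecay 2).mono (norm_pdC_pdC_le hf j)
  have hc0 : Continuous f := hf.continuous
  have hc1 (j : Fin d) : Continuous (pdC d j f) := (contDiff_pdC hf j).continuous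
  have hc2 (j : Fin d) : Continuous (pdC d j (pdC d j f)) :=
    (contDiff_pdC (contDiff_pdC hf j) j).continuous
  have hcont {g : EuclideanSpace ℝ (Fin d) → ℂ} (hg : Continuous g) :
      Continuous fun x => ((starRingEnd ℂ) (f x) * g x).im :=
    Complex.continuous_im.comp ((Complex.continuous_conj.comp hc0).mul hg)
  have hI (j : Fin d) : Integrable fun x => V x * ((starRingEnd ℂ) (f x) * pdC d j f x).im :=
    (hf0.im_conj_mul (hf1 j)).integrable_mul hV.continuous (hcont (hc1 j)) hVpoly
  have hI2 (j : Fin d) :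
      Integrable fun x => V x * ((starRingEnd ℂ) (f x) * pdC d j (pdC d j f) x).im :=
    (hf0.im_conj_mul (hf2 j)).integrable_mul hV.continuous (hcont (hc2 j)) hVpoly
  have hI1 (j : Fin d) :
      Integrable fun x => fderiv ℝ V x (EuclideanSpace.single j (1 : ℝ)) *
        ((starRingEnd ℂ) (f x) * pdC d j f x).im := by
    refine (hf0.im_conj_mul (hf1 j)).integrable_mul
      ((hV.continuous_fderiv (by simp)).clm_apply continuous_const) (hcont (hc1 j)) ?_
    obtain ⟨C, n, hC⟩ := hVgradpoly
    refine ⟨C, n, fun x => le_trans ?_ (hC x)⟩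
    simpa using (fderiv ℝ V x).le_opNorm (EuclideanSpace.single j (1 : ℝ))
  have hparts (j : Fin d) :
      ∫ x, V x * ((starRingEnd ℂ) (f x) * pdC d j (pdC d j f) x).im =
        -∫ x, fderiv ℝ V x (EuclideanSpace.single j (1 : ℝ)) *
          ((starRingEnd ℂ) (f x) * pdC d j f x).im := by
    simp only [← (differentiableAt_and_fderiv_current hf j _).2]
    refine integral_mul_fderiv_eq_neg_fderiv_mul_of_integrable (hI1 j) ?_ (hI j)
      (fun x _ => hV.differentiable (by simp) x) fun x _ => (differentiableAt_and_fderiv_current hf j x).1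
    simpa only [(differentiableAt_and_fderiv_current hf j _).2] using hI2 j
  rw [integral_finsetSum _ fun j _ => hI1 j, ← Finset.sum_neg_distrib]
  simp only [← hparts]
  rw [← integral_finsetSum _ fun j _ => hI2 j]
  refine integral_congr_ae (.of_forall fun x => ?_)
  simp only [lapC, Finset.mul_sum, Complex.im_sum]

end PartialDerivatives

/-- The local conservation law for the mass density `|z|²`, with `w` the time derivative,
`l` the Laplacian and `a`, `b` real coefficients. -/
theorem re_conj_mul_of_I_mul_eq {z w l : ℂ} {a b : ℝ}
    (h : Complex.I * w = -l + (a : ℂ) * z - (b : ℂ) * z) :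
    ((starRingEnd ℂ) z * w).re = -((starRingEnd ℂ) z * l).im := by
  have hre := congrArg Complex.re h
  have him := congrArg Complex.im h
  simp at hre him ⊢
  rw [him, show w.im = l.re - a * z.re + b * z.re by linarith]
  ring

theorem HasDerivAt.complex_normSq {f : ℝ → ℂ} {w : ℂ} {t : ℝ} (hf : HasDerivAt f w t) :
    HasDerivAt (fun τ => Complex.normSq (f τ)) (2 * ((starRingEnd ℂ) (f t) * w).re) t := by
  have hre : HasDerivAt (fun τ => (f τ).re) w.re t :=
    Complex.reCLM.hasFDerivAt.comp_hasDerivAt t hf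
  have him : HasDerivAt (fun τ => (f τ).im) w.im t :=
    Complex.imCLM.hasFDerivAt.comp_hasDerivAt t hf
  refine ((hre.mul hre).add (him.mul him)).congr_deriv ?_
  simp
  ring

/-- Time derivative of the potential energy along the flow: for a classical
Schwartz-class solution `ψ` of `i∂_tψ = (-Δ + V)ψ - h(|ψ|²)ψ`, the map
`t ↦ (1/2)∫V|ψ|²` is differentiable with derivative `∫ ∇V · Im(conj(ψ)∇ψ)`. -/
theorem potential_energy_time_derivative
    (d : ℕ) (hd : 1 ≤ d)
    (V : EuclideanSpace ℝ (Fin d) → ℝ) (hV : ContDiff ℝ 1 V)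
    (hVpoly : ∃ C : ℝ, ∃ n : ℕ, ∀ x, |V x| ≤ C * (1 + ‖x‖) ^ n)
    (hVgradpoly : ∃ C : ℝ, ∃ n : ℕ, ∀ x, ‖fderiv ℝ V x‖ ≤ C * (1 + ‖x‖) ^ n)
    (h : ℝ → ℝ) (hh : ContinuousOn h (Set.Ici 0))
    (ψ : ℝ → EuclideanSpace ℝ (Fin d) → ℂ)
    (hψ : ContDiff ℝ (⊤ : ℕ∞) (Function.uncurry ψ))
    (heq : ∀ t x, Complex.I * deriv (fun τ => ψ τ x) t =
      -(lapC d (ψ t) x) + (V x : ℂ) * ψ t x - (h (Complex.normSq (ψ t x)) : ℂ) * ψ t x)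
    (hdecay0 : ∀ J : Set ℝ, IsCompact J → ∀ n k : ℕ, ∃ C : ℝ,
      ∀ t ∈ J, ∀ x, (1 + ‖x‖) ^ k * ‖iteratedFDeriv ℝ n (ψ t) x‖ ≤ C)
    (hdecay1 : ∀ J : Set ℝ, IsCompact J → ∀ n k : ℕ, ∃ C : ℝ,
      ∀ t ∈ J, ∀ x, (1 + ‖x‖) ^ k *
        ‖iteratedFDeriv ℝ n (fun y => deriv (fun τ => ψ τ y) t) x‖ ≤ C) :
    ∀ t : ℝ, HasDerivAt
      (fun τ => (1 / 2) * ∫ x : EuclideanSpace ℝ (Fin d), V x * Complex.normSq (ψ τ x))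
      (∫ x : EuclideanSpace ℝ (Fin d), ∑ j : Fin d,
        fderiv ℝ V x (EuclideanSpace.single j (1 : ℝ)) *
          ((starRingEnd ℂ) (ψ t x) * pdC d j (ψ t) x).im) t := by
  intro t
  have hslice (τ : ℝ) : ContDiff ℝ (⊤ : ℕ∞) (ψ τ) :=
    hψ.comp (contDiff_const.prodMk contDiff_id)
  have hdecay (n : ℕ) : RapidDecay (iteratedFDeriv ℝ n (ψ t)) := fun k =>
    (hdecay0 {t} isCompact_singleton n k).imp fun _ hC => hC t rfl
  have hψ0 : RapidDecay (ψ t) := (hdecay 0).mono fun x => by simp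
  have htime (τ : ℝ) (x : EuclideanSpace ℝ (Fin d)) :
      HasDerivAt (fun s => ψ s x) (deriv (fun s => ψ s x) τ) τ := by
    have : ContDiff ℝ (⊤ : ℕ∞) fun s => ψ s x :=
      hψ.comp (contDiff_id.prodMk contDiff_const)
    exact (this.differentiable (by simp) τ).hasDerivAt
  have hmass (τ : ℝ) (x : EuclideanSpace ℝ (Fin d)) :
      HasDerivAt (fun s => V x * Complex.normSq (ψ s x))
        (V x * (-2 * ((starRingEnd ℂ) (ψ τ x) * lapC d (ψ τ) x).im)) τ := by
    have := (htime τ x).complex_normSq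
    rw [re_conj_mul_of_I_mul_eq (heq τ x)] at this
    exact (this.const_mul (V x)).congr_deriv (by ring)
  have hlapc : Continuous (lapC d (ψ t)) :=
    continuous_finsetSum _ fun j _ =>
      (contDiff_pdC (contDiff_pdC (hslice t) j) j).continuous
  obtain ⟨CV, n, hCV⟩ := hVpoly
  have hCV0 : 0 ≤ CV := (abs_nonneg _).trans (by simpa using hCV 0)
  obtain ⟨C, hC⟩ := hdecay0 _ (isCompact_closedBall t 1) 0 0
  obtain ⟨D, hD⟩ := hdecay1 _ (isCompact_closedBall t 1) 0 (n + (d + 1))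
  have hbound (x : EuclideanSpace ℝ (Fin d)) (τ : ℝ) (hτ : τ ∈ Metric.closedBall t 1) :
      ‖V x * (-2 * ((starRingEnd ℂ) (ψ τ x) * lapC d (ψ τ) x).im)‖ ≤
        CV * (2 * (C * D)) * (1 + ‖x‖) ^ (-((d + 1 : ℕ) : ℝ)) := by
    rw [norm_mul]
    refine growth_mul_decay_le (norm_nonneg x) hCV0 (norm_nonneg _) (hCV x) ?_
    have hψC : ‖ψ τ x‖ ≤ C := by simpa using hC τ hτ x
    have hψD : (1 + ‖x‖) ^ (n + (d + 1)) * ‖deriv (fun s => ψ s x) τ‖ ≤ D := by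
      simpa only [norm_iteratedFDeriv_zero] using hD τ hτ x
    have hflux : ‖-2 * ((starRingEnd ℂ) (ψ τ x) * lapC d (ψ τ) x).im‖ ≤
        2 * (‖ψ τ x‖ * ‖deriv (fun s => ψ s x) τ‖) := by
      rw [neg_mul, ← mul_neg, ← re_conj_mul_of_I_mul_eq (heq τ x), norm_mul, Real.norm_ofNat]
      gcongr
      simpa only [norm_mul, RCLike.norm_conj, Real.norm_eq_abs] using
        Complex.abs_re_le_norm ((starRingEnd ℂ) (ψ τ x) * deriv (fun s => ψ s x) τ)
    calc (1 + ‖x‖) ^ (n + (d + 1)) * ‖-2 * ((starRingEnd ℂ) (ψ τ x) * lapC d (ψ τ) x).im‖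
        ≤ (1 + ‖x‖) ^ (n + (d + 1)) * (2 * (‖ψ τ x‖ * ‖deriv (fun s => ψ s x) τ‖)) := by gcongr
      _ = 2 * (‖ψ τ x‖ * ((1 + ‖x‖) ^ (n + (d + 1)) * ‖deriv (fun s => ψ s x) τ‖)) := by ring
      _ ≤ 2 * (C * D) := by
        gcongr
        exact (norm_nonneg _).trans hψC
  have hnormSq (τ : ℝ) : Continuous fun x => Complex.normSq (ψ τ x) :=
    Complex.continuous_normSq.comp (hslice τ).continuous
  have hint : Integrable fun x => V x * Complex.normSq (ψ t x) := by
    refine RapidDecay.integrable_mul ?_ hV.continuous (hnormSq t) ⟨CV, n, hCV⟩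
    have hI : RapidDecay fun x => Complex.I * ψ t x := hψ0.mono fun x => by simp
    refine (hψ0.im_conj_mul hI).mono fun x => le_of_eq ?_
    congr 1
    simp [Complex.normSq_apply]
  have hderiv := (hasDerivAt_integral_of_dominated_loc_of_deriv_le
    (F := fun τ x => V x * Complex.normSq (ψ τ x))
    (Metric.closedBall_mem_nhds t one_pos)
    (.of_forall fun τ => (hV.continuous.mul (hnormSq τ)).aestronglyMeasurable) hint
    (hV.continuous.mul (continuous_const.mul (Complex.continuous_im.comp
      ((Complex.continuous_conj.comp (hslice t).continuous).mul hlapc)))).aestronglyMeasurable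
    (.of_forall hbound)
    ((integrable_one_add_norm (by simp)).const_mul _)
    (.of_forall fun x τ _ => hmass τ x)).2
  refine (hderiv.const_mul (1 / 2)).congr_deriv ?_
  simp only [mul_left_comm (V _) (-2 : ℝ), integral_const_mul]
  rw [integral_mul_im_conj_mul_lapC (hslice t) hdecay hV ⟨CV, n, hCV⟩ hVgradpoly]
  ring
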